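/- Fix k ≥ 1. Let u ∈ GL_{k+1}(K) be upper unitriangular with all off-diagonal entries in 𝒪₁ = t⁻¹ℂ[[t⁻¹]]. Suppose e := u^{(1)}_{1,k+1} ≠ 0, and set b_{k+1−i} := u^{(1)}_{i,k+1} for 2 ≤ i ≤ k, g_{k+1−j} := u^{(1)}_{1,j}/e for 2 ≤ j ≤ k, and p := u^{(2)}_{1,k+1}/e − ∑_{i=1}^{k−1} b_i g_i. Then y(p,e,b,g)^{−1} · u · diag(t^{−1}, 1, …, 1, t) lies in the first congruence subgroup I_{k+1} + t^{−1}·Mat_{k+1}(ℂ[[t⁻¹]]) of GL_{k+1}(ℂ[[t⁻¹]]). -/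

import Mathlib

open Matrix

noncomputable section

/-- `K = ℂ((t⁻¹))`, the field of formal Laurent series in `t⁻¹`.  We realize it as
`LaurentSeries ℂ`, where the Laurent-series variable `X` plays the role of `t⁻¹`;
thus for `f : K`, `f.coeff j` is the coefficient of `t^{-j}`. -/
abbrev K : Type := LaurentSeries ℂ

/-- The element `t` (the inverse of the Laurent series variable). -/
def tK : K := (HahnSeries.single (-1 : ℤ) (1 : ℂ))

/-- The constant embedding `ℂ → K`. -/
def Cc (z : ℂ) : K := HahnSeries.C z

/-- `f ∈ 𝒪 = ℂ[[t⁻¹]]` : no positive powers of `t`. -/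
def memO (f : K) : Prop := ∀ j : ℤ, j < 0 → f.coeff j = 0

/-- `f ∈ 𝒪₁ = t⁻¹ℂ[[t⁻¹]]`. -/
def memO1 (f : K) : Prop := ∀ j : ℤ, j ≤ 0 → f.coeff j = 0

/-- `f ∈ ℂ[t]`. -/
def memPoly (f : K) : Prop := ∀ j : ℤ, 0 < j → f.coeff j = 0

/-- Upper unitriangular matrix. -/
def IsUpperUni {R : Type*} [Zero R] [One R] {m : ℕ} (M : Matrix (Fin m) (Fin m) R) : Prop :=
  (∀ i, M i i = 1) ∧ ∀ i j : Fin m, j < i → M i j = 0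

/-- Lower unitriangular matrix. -/
def IsLowerUni {R : Type*} [Zero R] [One R] {m : ℕ} (M : Matrix (Fin m) (Fin m) R) : Prop :=
  (∀ i, M i i = 1) ∧ ∀ i j : Fin m, i < j → M i j = 0

/-- `M ∈ N₁[[t⁻¹]]` : upper unitriangular with off-diagonal entries in `𝒪₁`. -/
def MemN1 {m : ℕ} (M : Matrix (Fin m) (Fin m) K) : Prop :=
  IsUpperUni M ∧ ∀ i j : Fin m, i ≠ j → memO1 (M i j)

/-- `M ∈ N₋,₁[[t⁻¹]]`. -/
def MemN1neg {m : ℕ} (M : Matrix (Fin m) (Fin m) K) : Prop :=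
  IsLowerUni M ∧ ∀ i j : Fin m, i ≠ j → memO1 (M i j)

/-- `M ∈ T₁[[t⁻¹]]` : diagonal with entries in `1 + 𝒪₁`. -/
def MemT1 {m : ℕ} (M : Matrix (Fin m) (Fin m) K) : Prop :=
  (∀ i j : Fin m, i ≠ j → M i j = 0) ∧ ∀ i, memO1 (M i i - 1)

/-- `M ∈ N[t]` : upper unitriangular with entries in `ℂ[t]`. -/
def MemNpoly {m : ℕ} (M : Matrix (Fin m) (Fin m) K) : Prop :=
  IsUpperUni M ∧ ∀ i j : Fin m, memPoly (M i j)

/-- `M ∈ N₋[t]` : lower unitriangular with entries in `ℂ[t]`. -/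
def MemNnegPoly {m : ℕ} (M : Matrix (Fin m) (Fin m) K) : Prop :=
  IsLowerUni M ∧ ∀ i j : Fin m, memPoly (M i j)

/-- `t^ν = diag(t^{ν₁},…,t^{ν_m})`. -/
def tPow {m : ℕ} (ν : Fin m → ℤ) : Matrix (Fin m) (Fin m) K :=
  Matrix.diagonal fun i => tK ^ ν i

/-- `y = u · h · t^ν · l` is a Gauss factorization exhibiting membership in `Gr_ν`. -/
def IsGauss {m : ℕ} (ν : Fin m → ℤ) (y u h l : Matrix (Fin m) (Fin m) K) : Prop :=
  MemN1 u ∧ MemT1 h ∧ MemN1neg l ∧ y = u * h * tPow ν * l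

/-- The matrix slice `Gr_ν = N₁[[t⁻¹]]·T₁[[t⁻¹]]·t^ν·N₋,₁[[t⁻¹]]`. -/
def GrSlice {m : ℕ} (ν : Fin m → ℤ) : Set (Matrix (Fin m) (Fin m) K) :=
  { y | ∃ u h l, IsGauss ν y u h l }

/-- Block embedding `τ_α : Mat_{k+1} → Mat_n` into (1-indexed) rows and columns `r₁,…,r₁+k`,
identity outside this block. -/
def blockEmbed {R : Type*} [Zero R] [One R] (n r₁ k : ℕ)
    (g : Matrix (Fin (k+1)) (Fin (k+1)) R) : Matrix (Fin n) (Fin n) R :=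
  fun i j =>
    if h : r₁ - 1 ≤ (i : ℕ) ∧ (i : ℕ) ≤ r₁ - 1 + k ∧ r₁ - 1 ≤ (j : ℕ) ∧ (j : ℕ) ≤ r₁ - 1 + k then
      g ⟨(i : ℕ) - (r₁ - 1), by omega⟩ ⟨(j : ℕ) - (r₁ - 1), by omega⟩
    else if i = j then 1 else 0

/-- The coweight `α` of `PGL_n` : `α_{r₁} = 1`, `α_{r₂+1} = -1` (1-indexed), all other
entries `0`. -/
def alphaCo (n r₁ r₂ : ℕ) : Fin n → ℤ :=
  fun i => if (i : ℕ) = r₁ - 1 then 1 else if (i : ℕ) = r₂ then -1 else 0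

/-- The matrix `y(p,e,b,g)` (matrix representative of a point of the open Zastava
`Gr⁰_{-α}`), a `(k+1)×(k+1)` matrix over `ℂ[t] ⊆ K`. -/
def ymat (k : ℕ) (p e : ℂ) (b g : Fin (k-1) → ℂ) :
    Matrix (Fin (k+1)) (Fin (k+1)) K :=
  fun i j =>
    if _hi0 : (i : ℕ) = 0 then
      (if _hjk : (j : ℕ) = k then Cc e else 0)
    else if _hik : (i : ℕ) = k then
      (if _hj0 : (j : ℕ) = 0 then Cc (-e⁻¹)
       else if _hjk : (j : ℕ) = k then tK - Cc (p + ∑ l : Fin (k-1), b l * g l)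
       else Cc (-(g ⟨k - (j : ℕ) - 1, by have := j.isLt; omega⟩)))
    else
      (if _hji : (j : ℕ) = (i : ℕ) then 1
       else if _hjk : (j : ℕ) = k then Cc (b ⟨k - (i : ℕ) - 1, by have := i.isLt; omega⟩)
       else 0)

/-- The matrix `x₋(v)` over `K` : identity except for the bottom row `(v_k,…,v₁,1)`. -/
def xminusK (k : ℕ) (v : Fin k → ℂ) : Matrix (Fin (k+1)) (Fin (k+1)) K :=
  fun i j =>
    if _hik : (i : ℕ) = k then
      (if _hjk : (j : ℕ) = k then 1 else Cc (v ⟨k - (j : ℕ) - 1, by have := j.isLt; omega⟩))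
    else if i = j then 1 else 0

/-- `Φ_α(y)` read off from the `N₁[[t⁻¹]]`-factor `u` of a Gauss factorization of `y`. -/
def PhiOf (n r₂ k : ℕ) (hrn : r₂ < n) (u : Matrix (Fin n) (Fin n) K) : Fin k → ℂ :=
  fun a => (u ⟨r₂ - 1 - (a : ℕ), by omega⟩ ⟨r₂, hrn⟩).coeff 1

/-- `ζ_α(y)` read off from the `N₁[[t⁻¹]]`-factor `u` of a Gauss factorization of `y`. -/
def ZetaOf (n r₁ r₂ k : ℕ) (hr1 : 1 ≤ r₁) (hrr : r₁ ≤ r₂) (hrn : r₂ < n)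
    (hk : k = r₂ - r₁ + 1) (u : Matrix (Fin n) (Fin n) K) : Fin k → ℂ :=
  fun a =>
    if _ha : (a : ℕ) = k - 1 then (u ⟨r₁ - 1, by omega⟩ ⟨r₂, hrn⟩).coeff 2
    else (u ⟨r₁ - 1, by omega⟩ ⟨r₁ + (a : ℕ), by have := a.isLt; omega⟩).coeff 1

/-- `ξ_α(y)`, computed from the `N₁[[t⁻¹]]`-factor `u` of a Gauss factorization of `y`. -/
def xiOf (n r₁ r₂ k : ℕ) (hr1 : 1 ≤ r₁) (hrr : r₁ ≤ r₂) (hrn : r₂ < n)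
    (hk : k = r₂ - r₁ + 1) (u : Matrix (Fin n) (Fin n) K) : Matrix (Fin n) (Fin n) K :=
  let c := PhiOf n r₂ k hrn u
  let z := ZetaOf n r₁ r₂ k hr1 hrr hrn hk u
  let e : ℂ := c ⟨k - 1, by omega⟩
  let b : Fin (k-1) → ℂ := fun i => c ⟨(i : ℕ), by have := i.isLt; omega⟩
  let g : Fin (k-1) → ℂ := fun i => z ⟨k - (i : ℕ) - 2, by omega⟩ / e
  let p : ℂ := z ⟨k - 1, by omega⟩ / e - ∑ i : Fin (k-1), b i * g i
  blockEmbed n r₁ k (ymat k p e b g)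

/-- `M` has identity submatrix in (1-indexed) rows and columns `r₁,…,r₁+k`. -/
def HasIdBlock {R : Type*} [Zero R] [One R] {n : ℕ} (r₁ k : ℕ)
    (M : Matrix (Fin n) (Fin n) R) : Prop :=
  ∀ i j : Fin n, r₁ - 1 ≤ (i : ℕ) → (i : ℕ) ≤ r₁ - 1 + k →
    r₁ - 1 ≤ (j : ℕ) → (j : ℕ) ≤ r₁ - 1 + k →
    M i j = if i = j then 1 else 0

/-- `M ∈ N^α(K)` : upper unitriangular over `K` with identity `(k+1)×(k+1)`-block. -/
def MemNalphaK (n r₁ k : ℕ) (M : Matrix (Fin n) (Fin n) K) : Prop :=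
  IsUpperUni M ∧ HasIdBlock r₁ k M

/-- `M ∈ N^α[t]`. -/
def MemNalphaPoly (n r₁ k : ℕ) (M : Matrix (Fin n) (Fin n) K) : Prop :=
  MemNalphaK n r₁ k M ∧ ∀ i j : Fin n, memPoly (M i j)

/-- `M ∈ N(K)^α₁ = x_α(N_{1,k+1}[[t⁻¹]])·N^α(K)`. -/
def MemNKalpha1 (n r₁ k : ℕ) (M : Matrix (Fin n) (Fin n) K) : Prop :=
  ∃ (a : Matrix (Fin (k+1)) (Fin (k+1)) K) (u : Matrix (Fin n) (Fin n) K),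
    MemN1 a ∧ MemNalphaK n r₁ k u ∧ M = blockEmbed n r₁ k a * u

/-- `z = π(x)` for the slice `Gr_ν` : `z ∈ Gr_ν` and `z = a·x·b` with `a ∈ N[t]`,
`b ∈ N₋[t]`. -/
def IsPiOf {n : ℕ} (ν : Fin n → ℤ) (x z : Matrix (Fin n) (Fin n) K) : Prop :=
  z ∈ GrSlice ν ∧ ∃ a b, MemNpoly a ∧ MemNnegPoly b ∧ z = a * x * b

/-- The open Zastava slice `Gr⁰_{-α} ⊆ GL_n(K)` : matrices `τ_α(y(p,e,b,g))`. -/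
def GrZeroNegAlpha (n r₁ k : ℕ) : Set (Matrix (Fin n) (Fin n) K) :=
  { M | ∃ (p e : ℂ) (b g : Fin (k-1) → ℂ), e ≠ 0 ∧ M = blockEmbed n r₁ k (ymat k p e b g) }

/-- `μ + α`. -/
def addAlpha (n r₁ r₂ : ℕ) (μ : Fin n → ℤ) : Fin n → ℤ :=
  fun i => μ i + alphaCo n r₁ r₂ i


/-- `e := u^{(1)}_{1,k+1}`. -/
def eOf (k : ℕ) (u : Matrix (Fin (k+1)) (Fin (k+1)) K) : ℂ :=
  (u ⟨0, by omega⟩ ⟨k, by omega⟩).coeff 1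

/-- `b_{k+1−i} := u^{(1)}_{i,k+1}` for `2 ≤ i ≤ k`. -/
def bOf (k : ℕ) (u : Matrix (Fin (k+1)) (Fin (k+1)) K) : Fin (k-1) → ℂ :=
  fun i => (u ⟨k - (i : ℕ) - 1, by omega⟩ ⟨k, by omega⟩).coeff 1

/-- `g_{k+1−j} := u^{(1)}_{1,j}/e` for `2 ≤ j ≤ k`. -/
def gOf (k : ℕ) (u : Matrix (Fin (k+1)) (Fin (k+1)) K) : Fin (k-1) → ℂ :=
  fun j => (u ⟨0, by omega⟩ ⟨k - (j : ℕ) - 1, by omega⟩).coeff 1 / eOf k u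

/-- `p := u^{(2)}_{1,k+1}/e − ∑_{i=1}^{k−1} b_i g_i`. -/
def pOf (k : ℕ) (u : Matrix (Fin (k+1)) (Fin (k+1)) K) : ℂ :=
  (u ⟨0, by omega⟩ ⟨k, by omega⟩).coeff 2 / eOf k u -
    ∑ i : Fin (k-1), bOf k u i * gOf k u i

theorem Fin.forall_first_middle_last {m : ℕ} {P : Fin (m + 2) → Prop} :
    (∀ i, P i) ↔ P 0 ∧ (∀ a : Fin m, P a.castSucc.succ) ∧ P (Fin.last (m + 1)) := by
  rw [Fin.forall_fin_succ, Fin.forall_fin_succ', Fin.succ_last]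

theorem Fin.sum_first_middle_last {M : Type*} [AddCommMonoid M] {m : ℕ} (f : Fin (m + 2) → M) :
    ∑ i, f i = f 0 + (∑ a : Fin m, f a.castSucc.succ + f (Fin.last (m + 1))) := by
  rw [Fin.sum_univ_succ, Fin.sum_univ_castSucc, Fin.succ_last]

theorem coeff_Cc (c : ℂ) (n : ℤ) : (Cc c).coeff n = if n = 0 then c else 0 := by
  simp [Cc, HahnSeries.coeff_single]

theorem coeff_Cc_mul (c : ℂ) (f : K) (n : ℤ) : (Cc c * f).coeff n = c * f.coeff n := by
  simp [Cc]

theorem coeff_tK_mul (f : K) (n : ℤ) : (tK * f).coeff n = f.coeff (n + 1) := by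
  have := HahnSeries.coeff_single_mul_add (r := (1 : ℂ)) (x := f) (a := n + 1) (b := -1)
  simpa [tK] using this

theorem coeff_tK_inv (n : ℤ) : (tK⁻¹ : K).coeff n = if n = 1 then 1 else 0 := by
  have : (tK⁻¹ : K) = HahnSeries.single 1 1 := by
    rw [tK, HahnSeries.inv_single]; simp
  rw [this, HahnSeries.coeff_single]
  congr

theorem tK_ne_zero : tK ≠ 0 := by simp [tK]

section ymat

variable {m : ℕ} (p e : ℂ) (b g : Fin m → ℂ)

theorem ymat_first_row (j : Fin (m + 2)) :
    ymat (m + 1) p e b g 0 j = if j = Fin.last (m + 1) then Cc e else 0 := by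
  simp [ymat, Fin.ext_iff]

theorem ymat_middle_row (a : Fin m) (j : Fin (m + 2)) :
    ymat (m + 1) p e b g a.castSucc.succ j =
      if j = a.castSucc.succ then 1
      else if j = Fin.last (m + 1) then Cc (b a.rev) else 0 := by
  have h : (a : ℕ) ≠ m := a.isLt.ne
  have hr : ∀ h', (⟨m - a - 1, h'⟩ : Fin m) = a.rev := fun _ => by
    ext; simp [Fin.val_rev]; omega
  simp [ymat, Fin.ext_iff, h, hr]

theorem ymat_last_first : ymat (m + 1) p e b g (Fin.last (m + 1)) 0 = Cc (-e⁻¹) := by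
  simp [ymat]

theorem ymat_last_middle (a : Fin m) :
    ymat (m + 1) p e b g (Fin.last (m + 1)) a.castSucc.succ = Cc (-g a.rev) := by
  have h : (a : ℕ) ≠ m := a.isLt.ne
  have hr : ∀ h', (⟨m - a - 1, h'⟩ : Fin m) = a.rev := fun _ => by
    ext; simp [Fin.val_rev]; omega
  simp [ymat, h, hr]

theorem ymat_last_last :
    ymat (m + 1) p e b g (Fin.last (m + 1)) (Fin.last (m + 1)) =
      tK - Cc (p + ∑ a, b a * g a) := by
  simp [ymat]

/-- The solution `x` of the linear system `y(p,e,b,g) * x = w`. -/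
def ymatSolve (w : Matrix (Fin (m + 2)) (Fin (m + 2)) K) :
    Matrix (Fin (m + 2)) (Fin (m + 2)) K :=
  fun i j =>
    Fin.cons (α := fun _ => K)
      (tK * w 0 j - Cc p * w 0 j - Cc e * ∑ a : Fin m, Cc (g a.rev) * w a.castSucc.succ j
        - Cc e * w (Fin.last (m + 1)) j)
      (Fin.snoc (α := fun _ => K)
        (fun a : Fin m => w a.castSucc.succ j - Cc (b a.rev * e⁻¹) * w 0 j)
        (Cc e⁻¹ * w 0 j)) i

variable (w : Matrix (Fin (m + 2)) (Fin (m + 2)) K) (j : Fin (m + 2))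

theorem ymatSolve_first :
    ymatSolve p e b g w 0 j =
      tK * w 0 j - Cc p * w 0 j - Cc e * ∑ a : Fin m, Cc (g a.rev) * w a.castSucc.succ j
        - Cc e * w (Fin.last (m + 1)) j := rfl

theorem ymatSolve_middle (a : Fin m) :
    ymatSolve p e b g w a.castSucc.succ j =
      w a.castSucc.succ j - Cc (b a.rev * e⁻¹) * w 0 j := by
  simp [ymatSolve]

theorem ymatSolve_last :
    ymatSolve p e b g w (Fin.last (m + 1)) j = Cc e⁻¹ * w 0 j := by
  rw [← Fin.succ_last]
  simp [ymatSolve, -Fin.succ_last]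

variable {e}

theorem ymat_mul_ymatSolve (he : e ≠ 0) :
    ymat (m + 1) p e b g * ymatSolve p e b g w = w := by
  have hee : Cc e * Cc e⁻¹ = 1 := by simp only [Cc]; rw [← map_mul, mul_inv_cancel₀ he, map_one]
  ext1 i j
  revert i
  rw [Fin.forall_first_middle_last]
  refine ⟨?_, fun a => ?_, ?_⟩
  · simp only [Matrix.mul_apply, ymat_first_row, ite_mul, zero_mul, Finset.sum_ite_eq',
      Finset.mem_univ, if_true, ymatSolve_last]
    rw [← mul_assoc, hee, one_mul]
  · have h : ∀ a' : Fin m, a'.castSucc.succ ≠ Fin.last (m + 1) := fun a' => by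
      simpa [Fin.ext_iff] using a'.isLt.ne
    simp only [Matrix.mul_apply, ymat_middle_row, Fin.sum_first_middle_last, ymatSolve_last,
      ymatSolve_middle, h, (h a).symm, (Fin.succ_ne_zero a.castSucc).symm, if_false,
      Fin.succ_inj, Fin.castSucc_inj, ite_mul, zero_mul, one_mul, Finset.sum_ite_eq',
      Finset.mem_univ, if_true, (Fin.last_pos).ne, zero_add]
    simp only [Cc, map_mul]
    ring
  · have hs : ∑ a, b a * g a = ∑ a : Fin m, b a.rev * g a.rev :=
      (Equiv.sum_comp Fin.revPerm fun a => b a * g a).symm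
    have hm : ∑ a : Fin m, Cc (-g a.rev) * (w a.castSucc.succ j - Cc (b a.rev * e⁻¹) * w 0 j) =
        Cc (∑ a, b a * g a) * (Cc e⁻¹ * w 0 j)
          - ∑ a : Fin m, Cc (g a.rev) * w a.castSucc.succ j := by
      simp only [hs, Cc, map_sum, map_mul, map_neg, Finset.sum_mul, ← Finset.sum_sub_distrib]
      exact Finset.sum_congr rfl fun a _ => by ring
    have hn : Cc (-e⁻¹) = -Cc e⁻¹ := by simp [Cc]
    have ha : Cc (p + ∑ a, b a * g a) = Cc p + Cc (∑ a, b a * g a) :=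
      map_add HahnSeries.C _ _
    rw [Matrix.mul_apply, Fin.sum_first_middle_last]
    simp only [ymat_last_first, ymat_last_middle, ymat_last_last, ymatSolve_first,
      ymatSolve_middle, ymatSolve_last]
    rw [hm, hn, ha]
    linear_combination (w (Fin.last (m + 1)) j +
      ∑ a : Fin m, Cc (g a.rev) * w a.castSucc.succ j) * hee

theorem inv_ymat_mul (he : e ≠ 0) :
    (ymat (m + 1) p e b g)⁻¹ * w = ymatSolve p e b g w := by
  have h1 := ymat_mul_ymatSolve p b g 1 he
  have h2 := mul_eq_one_comm.mp h1
  rw [Matrix.inv_eq_right_inv h1]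
  conv_lhs => rw [← ymat_mul_ymatSolve p b g w he]
  rw [← Matrix.mul_assoc, h2, Matrix.one_mul]

end ymat

theorem MemN1.coeff_of_nonpos {m : ℕ} {u : Matrix (Fin m) (Fin m) K} (hu : MemN1 u)
    (i j : Fin m) {n : ℤ} (hn : n ≤ 0) :
    (u i j).coeff n = if i = j ∧ n = 0 then 1 else 0 := by
  by_cases h : i = j
  · subst h
    simp [hu.1.1, HahnSeries.coeff_one]
  · simp [h, hu.2 i j h n hn]

theorem eOf_succ {m : ℕ} (u : Matrix (Fin (m + 2)) (Fin (m + 2)) K) :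
    eOf (m + 1) u = (u 0 (Fin.last (m + 1))).coeff 1 := rfl

theorem bOf_rev {m : ℕ} (u : Matrix (Fin (m + 2)) (Fin (m + 2)) K) (a : Fin m) :
    bOf (m + 1) u a.rev = (u a.castSucc.succ (Fin.last (m + 1))).coeff 1 := by
  have h : ∀ h', (⟨m + 1 - (a.rev : ℕ) - 1, h'⟩ : Fin (m + 2)) = a.castSucc.succ := fun _ => by
    ext; simp [Fin.val_rev]
  simp only [bOf]
  rw [h]
  congr

theorem gOf_rev {m : ℕ} (u : Matrix (Fin (m + 2)) (Fin (m + 2)) K) (a : Fin m) :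
    gOf (m + 1) u a.rev = (u 0 a.castSucc.succ).coeff 1 / eOf (m + 1) u := by
  have h : ∀ h', (⟨m + 1 - (a.rev : ℕ) - 1, h'⟩ : Fin (m + 2)) = a.castSucc.succ := fun _ => by
    ext; simp [Fin.val_rev]
  simp only [gOf]
  rw [h]
  congr

theorem pOf_succ {m : ℕ} (u : Matrix (Fin (m + 2)) (Fin (m + 2)) K) :
    pOf (m + 1) u = (u 0 (Fin.last (m + 1))).coeff 2 / eOf (m + 1) u -
      ∑ a : Fin m, bOf (m + 1) u a.rev * gOf (m + 1) u a.rev := by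
  have := Equiv.sum_comp Fin.revPerm fun a : Fin m => bOf (m + 1) u a * gOf (m + 1) u a
  simp only [Fin.revPerm_apply] at this
  rw [this]
  rfl

/-- If `u` is upper unitriangular over `K` with off-diagonal entries
in `𝒪₁` and `e = u^{(1)}_{1,k+1} ≠ 0`, then `y(p,e,b,g)⁻¹ · u · diag(t⁻¹,1,…,1,t)`
lies in the first congruence subgroup `I + t⁻¹·Mat_{k+1}(ℂ[[t⁻¹]])`. -/
theorem statement14 (k : ℕ) (hk : 1 ≤ k) (u : Matrix (Fin (k+1)) (Fin (k+1)) K)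
    (hu : MemN1 u) (he : eOf k u ≠ 0) :
    ∀ i j : Fin (k+1),
      memO1 ((((ymat k (pOf k u) (eOf k u) (bOf k u) (gOf k u))⁻¹ * u *
        tPow (fun i : Fin (k+1) =>
          if (i : ℕ) = 0 then (-1 : ℤ) else if (i : ℕ) = k then 1 else 0)) -
        1) i j) := by
  obtain ⟨m, rfl⟩ : ∃ m, k = m + 1 := ⟨k - 1, by omega⟩
  rw [Matrix.mul_assoc, inv_ymat_mul _ _ _ _ he]
  have hp := pOf_succ u
  have hb := bOf_rev u
  have hg := gOf_rev u
  have hE := eOf_succ u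
  generalize pOf (m + 1) u = p at *
  generalize eOf (m + 1) u = e at *
  generalize bOf (m + 1) u = b at *
  generalize gOf (m + 1) u = g at *
  have hc := fun i j => @MemN1.coeff_of_nonpos _ _ hu i j
  have hne : ∀ a : Fin m, a.castSucc.succ ≠ Fin.last (m + 1) := fun a => by
    simpa [Fin.ext_iff] using a.isLt.ne
  have ham : ∀ a : Fin m, (a : ℕ) ≠ m := fun a => a.isLt.ne
  have hlast : Fin.last (m + 1) ≠ 0 := Fin.last_pos.ne'
  intro i j n hn
  revert i j
  rw [forall_comm, Fin.forall_first_middle_last]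
  refine ⟨?_, fun c => ?_, ?_⟩ <;> rw [Fin.forall_first_middle_last] <;>
    refine ⟨?_, fun a => ?_, ?_⟩ <;>
    simp only [Matrix.sub_apply, ymatSolve_first, ymatSolve_middle, ymatSolve_last, tPow,
      Matrix.mul_diagonal]
  · simp [hu.1.1, hu.1.2 _ _ (Fin.succ_pos _), hu.1.2 _ _ Fin.last_pos, tK_ne_zero,
      coeff_Cc_mul, coeff_tK_inv, show n ≠ 1 by omega]
  · simp [hu.1.1, hu.1.2 _ _ (Fin.succ_pos _), coeff_Cc_mul, coeff_tK_inv, show n ≠ 1 by omega,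
      Matrix.one_apply_ne (Fin.succ_ne_zero _)]
  · simp [hu.1.1, coeff_Cc_mul, coeff_tK_inv, show n ≠ 1 by omega,
      Matrix.one_apply_ne hlast]
  · have h1 : u (Fin.last (m + 1)) c.castSucc.succ = 0 :=
      hu.1.2 _ _ (lt_of_le_of_ne (Fin.le_last _) (hne c))
    have h0 := Fin.succ_ne_zero c.castSucc
    simp [h1, ham, coeff_Cc_mul, coeff_tK_mul, hc _ _ hn, Matrix.one_apply_ne h0.symm, h0.symm]
    rcases hn.lt_or_eq with hn' | rfl
    · simp [hc _ _ (show n + 1 ≤ 0 by omega), hn'.ne, h0.symm]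
    · simp [hg]
      field_simp
      ring
  · have h0 := Fin.succ_ne_zero c.castSucc
    simp [ham, coeff_Cc_mul, hc _ _ hn, h0.symm, Matrix.one_apply]
    split_ifs <;> simp_all [HahnSeries.coeff_one]
  · have h0 := Fin.succ_ne_zero c.castSucc
    simp [ham, coeff_Cc_mul, hc _ _ hn, h0.symm, Matrix.one_apply_ne (hne c).symm]
  · simp [mul_comm _ tK, coeff_Cc, coeff_Cc_mul, coeff_tK_mul, Matrix.one_apply_ne hlast.symm,
      hu.1.1]
    obtain rfl | rfl | hn' : n = 0 ∨ n = -1 ∨ n + 1 + 1 ≤ 0 := by omega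
    · have hs : e * ∑ a : Fin m, g a.rev * b a.rev = e * ∑ a : Fin m, b a.rev * g a.rev := by
        simp only [mul_comm (g _)]
      simp [← hb, ← hE, hp]
      rw [hs]
      field_simp
      ring
    · simp [hc _ _ le_rfl, hlast.symm, ← hE, hne]
    · simp [hc _ _ hn', hc _ _ (show n + 1 ≤ 0 by omega), hlast.symm, hne,
        show n + 1 ≠ 0 by omega]
  · simp [mul_comm _ tK, coeff_Cc_mul, coeff_tK_mul, Matrix.one_apply_ne (hne a)]
    obtain rfl | hn' : n = 0 ∨ n + 1 ≤ 0 := by omega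
    · simp [← hb, ← hE, he]
    · simp [hc _ _ hn', hlast.symm, hne]
  · simp [mul_comm _ tK, coeff_Cc_mul, coeff_tK_mul]
    obtain rfl | hn' : n = 0 ∨ n + 1 ≤ 0 := by omega
    · simp [← hE, he]
    · simp [hc _ _ hn', hlast.symm, show n ≠ 0 by omega]

end
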